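/- arXiv:1711.08911 — 3 statements merged into one kernel-verified Lean document; each statement's English description precedes it below -/
import Mathlib

section
/- Let d ≥ 1 be an integer and let φ : [0,∞) → ℝ be twice continuously differentiable with φ'(0) = 0 and φ''(r) > 0 for all r ≥ 0. Define ψ(z) = −(2d−1)·log z + φ(z²) for z > 0. Then ψ''(z) = (2d−1)/z² + 2·φ'(z²) + 4·z²·φ''(z²) > 0 for all z > 0, and moreover for every z₀ > 0 one has inf_{z>0} ψ''(z) ≥ min{(2d−1)/z₀², 2·φ'(z₀²)} > 0; in particular ψ is strongly convex on (0,∞). -/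
open Set Real

theorem strictMonoOn_Ici_of_hasDerivWithinAt_pos {f f' : ℝ → ℝ} {a : ℝ}
    (hf : ∀ x ∈ Set.Ici a, HasDerivWithinAt f (f' x) (Set.Ici a) x)
    (hpos : ∀ x ∈ Set.Ici a, 0 < f' x) : StrictMonoOn f (Set.Ici a) := by
  refine strictMonoOn_of_deriv_pos (convex_Ici a) (fun x hx => (hf x hx).continuousWithinAt) ?_
  intro x hx
  rw [interior_Ici] at hx
  have hxa : x ∈ Set.Ici a := Set.Ioi_subset_Ici_self hx
  rw [((hf x hxa).hasDerivAt (Ici_mem_nhds hx)).deriv]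
  exact hpos x hxa

theorem hasDerivAt_comp_sq {f f' : ℝ → ℝ}
    (hf : ∀ x ∈ Set.Ici (0:ℝ), HasDerivWithinAt f (f' x) (Set.Ici 0) x) {z : ℝ} (hz : 0 < z) :
    HasDerivAt (fun x => f (x ^ 2)) (f' (z ^ 2) * (2 * z)) z := by
  have hz2 : 0 < z ^ 2 := by positivity
  have h : HasDerivAt f (f' (z ^ 2)) (z ^ 2) := (hf _ hz2.le).hasDerivAt (Ici_mem_nhds hz2)
  simpa [Function.comp_def] using HasDerivAt.comp (h := fun x => x ^ 2) z h (hasDerivAt_pow 2 z)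

/-- Uniqueness of derivatives, for functions agreeing on the positive half-line. -/
theorem hasDerivAt_unique_of_eqOn_pos {f g : ℝ → ℝ} {a b z : ℝ} (hz : 0 < z)
    (hfg : ∀ x > (0:ℝ), f x = g x) (hf : HasDerivAt f a z) (hg : HasDerivAt g b z) : a = b :=
  hf.unique (hg.congr_of_eventuallyEq (Filter.eventually_of_mem (Ioi_mem_nhds hz) hfg))

/-- Let `d ≥ 1` and `φ : [0,∞) → ℝ` be twice continuously differentiable
(encoded by `φ', φ''` successive derivatives on `[0,∞)`, `φ''` continuous) with `φ'(0) = 0` and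
`φ''(r) > 0` for all `r ≥ 0`. Let `ψ(z) = −(2d−1)·log z + φ(z²)` for `z > 0`, and let
`ψ', ψ''` be its first and second derivatives on `(0,∞)`. Then
`ψ''(z) = (2d−1)/z² + 2φ'(z²) + 4z²φ''(z²) > 0` for all `z > 0`, for every `z₀ > 0` one has
`inf_{z>0} ψ''(z) ≥ min{(2d−1)/z₀², 2φ'(z₀²)} > 0`, and in particular `ψ` is strongly convex
on `(0,∞)` (its second derivative is bounded below by a positive constant). -/
theorem stmt_8 (d : ℕ) (hd : 1 ≤ d) (φ φ' φ'' : ℝ → ℝ)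
    (hD1 : ∀ r ∈ Set.Ici (0:ℝ), HasDerivWithinAt φ (φ' r) (Set.Ici 0) r)
    (hD2 : ∀ r ∈ Set.Ici (0:ℝ), HasDerivWithinAt φ' (φ'' r) (Set.Ici 0) r)
    (hcont : ContinuousOn φ'' (Set.Ici 0))
    (h1 : φ' 0 = 0) (hpos : ∀ r ∈ Set.Ici (0:ℝ), 0 < φ'' r)
    (ψ ψ' ψ'' : ℝ → ℝ)
    (hψ : ∀ z > (0:ℝ), ψ z = -(2*(d:ℝ)-1) * Real.log z + φ (z^2))
    (hψ1 : ∀ z > (0:ℝ), HasDerivAt ψ (ψ' z) z)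
    (hψ2 : ∀ z > (0:ℝ), HasDerivAt ψ' (ψ'' z) z) :
    (∀ z > (0:ℝ),
        ψ'' z = (2*(d:ℝ)-1)/z^2 + 2*φ' (z^2) + 4*z^2*φ'' (z^2) ∧ 0 < ψ'' z) ∧
    (∀ z₀ > (0:ℝ),
        (∀ z > (0:ℝ), min ((2*(d:ℝ)-1)/z₀^2) (2*φ' (z₀^2)) ≤ ψ'' z) ∧
        0 < min ((2*(d:ℝ)-1)/z₀^2) (2*φ' (z₀^2))) ∧
    (∃ c > (0:ℝ), ∀ z > (0:ℝ), c ≤ ψ'' z) := by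
  have hk : 0 < 2 * (d:ℝ) - 1 := by
    have : (1:ℝ) ≤ d := by exact_mod_cast hd
    linarith
  have hmono := strictMonoOn_Ici_of_hasDerivWithinAt_pos hD2 hpos
  have hφ' : ∀ z > (0:ℝ), 0 < φ' (z^2) := fun z hz => by
    have hz2 : 0 < z^2 := by positivity
    simpa [h1] using hmono Set.self_mem_Ici (Set.mem_Ici.2 hz2.le) hz2
  have hψ'_eq : ∀ z > (0:ℝ), ψ' z = -(2*(d:ℝ)-1) * z⁻¹ + φ' (z^2) * (2*z) := fun z hz =>
    hasDerivAt_unique_of_eqOn_pos hz hψ (hψ1 z hz)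
      (((Real.hasDerivAt_log hz.ne').const_mul _).add (hasDerivAt_comp_sq hD1 hz))
  have hψ''_eq : ∀ z > (0:ℝ),
      ψ'' z = (2*(d:ℝ)-1)/z^2 + 2*φ' (z^2) + 4*z^2*φ'' (z^2) := fun z hz => by
    rw [hasDerivAt_unique_of_eqOn_pos hz hψ'_eq (hψ2 z hz)
      (((hasDerivAt_inv hz.ne').const_mul _).add
        ((hasDerivAt_comp_sq hD2 hz).mul ((hasDerivAt_id' z).const_mul 2)))]
    field_simp
    ring
  have hφ'' : ∀ z > (0:ℝ), 0 < 4*z^2*φ'' (z^2) := fun z hz =>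
    mul_pos (by positivity) (hpos _ (Set.mem_Ici.2 (sq_nonneg z)))
  have hmin_pos : ∀ z₀ > (0:ℝ), 0 < min ((2*(d:ℝ)-1)/z₀^2) (2*φ' (z₀^2)) := fun z₀ hz₀ =>
    lt_min (by positivity) (mul_pos two_pos (hφ' z₀ hz₀))
  have hbound : ∀ z₀ > (0:ℝ), ∀ z > (0:ℝ),
      min ((2*(d:ℝ)-1)/z₀^2) (2*φ' (z₀^2)) ≤ ψ'' z := fun z₀ hz₀ z hz => by
    rw [hψ''_eq z hz]
    have hlog : 0 < (2*(d:ℝ)-1)/z^2 := by positivity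
    have hp := hφ' z hz
    have hpp := hφ'' z hz
    rcases le_total z z₀ with h | h
    · have : (2*(d:ℝ)-1)/z₀^2 ≤ (2*(d:ℝ)-1)/z^2 := by gcongr
      exact (min_le_left _ _).trans (by linarith)
    · have : φ' (z₀^2) ≤ φ' (z^2) :=
        hmono.monotoneOn (Set.mem_Ici.2 (sq_nonneg z₀)) (Set.mem_Ici.2 (sq_nonneg z)) (by gcongr)
      exact (min_le_right _ _).trans (by linarith)
  exact ⟨fun z hz => ⟨hψ''_eq z hz, (hmin_pos z hz).trans_le (hbound z hz z hz)⟩,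
    fun z₀ hz₀ => ⟨hbound z₀ hz₀, hmin_pos z₀ hz₀⟩,
    _, hmin_pos 1 one_pos, hbound 1 one_pos⟩
end

section
/- Let d ≥ 1 be an integer and let φ : [0,∞) → ℝ be four times continuously differentiable with φ'(0) = 0, φ''(0) = 1, and φ''(r) > 0 for all r ≥ 0; let Δ3 = φ'''(0), and suppose Δ4 > 0 satisfies |φ''''(r)| ≤ Δ4 for all r ≥ 0. Set r₀ = (Δ3 + √(Δ3² + 2Δ4))/Δ4 and ψ(z) = −(2d−1)·log z + φ(z²) for z > 0. Then: (i) for all z > 0 with z² ≤ r₀, ψ''(z) ≥ (2d−1)/z² + 6z² + 5·Δ3·z⁴ − (7/3)·Δ4·z⁶; and (ii) for all z > 0 with z² ≥ r₀, ψ''(z) ≥ 2·(r₀ + Δ3·r₀²/2 − Δ4·r₀³/6). -/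
open Set Real

/-- A function on `[0, ∞)` with nonnegative one-sided derivative is monotone. -/
lemma monotoneOn_Ici_of_hasDerivWithinAt_nonneg {f f' : ℝ → ℝ}
    (hf : ∀ r ∈ Set.Ici (0:ℝ), HasDerivWithinAt f (f' r) (Set.Ici 0) r)
    (hf' : ∀ r ∈ Set.Ici (0:ℝ), 0 ≤ f' r) : MonotoneOn f (Set.Ici 0) :=
  monotoneOn_of_hasDerivWithinAt_nonneg (convex_Ici 0)
    (fun r hr => (hf r hr).continuousWithinAt)
    (fun r hr => (hf r (interior_subset hr)).mono interior_subset)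
    (fun r hr => hf' r (interior_subset hr))

/-- Integrating an inequality of derivatives over `[0, r]`. -/
lemma le_of_hasDerivWithinAt_le_Ici {f f' g g' : ℝ → ℝ}
    (hf : ∀ r ∈ Set.Ici (0:ℝ), HasDerivWithinAt f (f' r) (Set.Ici 0) r)
    (hg : ∀ r, HasDerivAt g (g' r) r) (h0 : g 0 = f 0)
    (hle : ∀ r ∈ Set.Ici (0:ℝ), g' r ≤ f' r) :
    ∀ r ∈ Set.Ici (0:ℝ), g r ≤ f r := by
  intro r hr
  have h := monotoneOn_Ici_of_hasDerivWithinAt_nonneg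
    (fun x hx => (hf x hx).sub (hg x).hasDerivWithinAt)
    (fun x hx => sub_nonneg.2 (hle x hx)) Set.self_mem_Ici hr hr
  simp only [Pi.sub_apply] at h
  linarith

/-- The second derivative of `z ↦ -c * log z + φ (z ^ 2)` on `(0, ∞)`. -/
lemma second_deriv_neg_log_add_comp_sq {c : ℝ} {φ φ' φ'' ψ ψ' ψ'' : ℝ → ℝ}
    (hD1 : ∀ r ∈ Set.Ici (0:ℝ), HasDerivWithinAt φ (φ' r) (Set.Ici 0) r)
    (hD2 : ∀ r ∈ Set.Ici (0:ℝ), HasDerivWithinAt φ' (φ'' r) (Set.Ici 0) r)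
    (hψ : ∀ z > (0:ℝ), ψ z = -c * Real.log z + φ (z^2))
    (hψ1 : ∀ z > (0:ℝ), HasDerivAt ψ (ψ' z) z)
    (hψ2 : ∀ z > (0:ℝ), HasDerivAt ψ' (ψ'' z) z) {z : ℝ} (hz : 0 < z) :
    ψ'' z = c / z^2 + 2 * φ' (z^2) + 4 * z^2 * φ'' (z^2) := by
  have hsq (x : ℝ) : HasDerivAt (fun y : ℝ => y^2) (2 * x) x := by
    simpa using hasDerivAt_pow 2 x
  have hcomp {f f' : ℝ → ℝ}
      (hf : ∀ r ∈ Set.Ici (0:ℝ), HasDerivWithinAt f (f' r) (Set.Ici 0) r)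
      {x : ℝ} (hx : 0 < x) : HasDerivAt (fun y => f (y^2)) (f' (x^2) * (2 * x)) x :=
    HasDerivAt.comp (h := fun y : ℝ => y^2) x
      ((hf (x^2) (sq_nonneg x)).hasDerivAt (Ici_mem_nhds (by positivity))) (hsq x)
  have hfirst : ∀ x > (0:ℝ), ψ' x = -c * x⁻¹ + φ' (x^2) * (2 * x) := by
    intro x hx
    refine (hψ1 x hx).unique ?_
    refine (((Real.hasDerivAt_log hx.ne').const_mul (-c)).add (hcomp hD1 hx)).congr_of_eventuallyEq ?_
    filter_upwards [Ioi_mem_nhds hx] with y hy using hψ y hy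
  have hsecond : HasDerivAt ψ' (-c * (-(z^2)⁻¹) +
      (φ'' (z^2) * (2 * z) * (2 * z) + φ' (z^2) * (2 * 1))) z := by
    refine (((hasDerivAt_inv hz.ne').const_mul (-c)).add
      ((hcomp hD2 hz).mul ((hasDerivAt_id z).const_mul 2))).congr_of_eventuallyEq ?_
    filter_upwards [Ioi_mem_nhds hz] with y hy using hfirst y hy
  rw [(hψ2 z hz).unique hsecond]
  ring

/-- Let `d ≥ 1` and `φ : [0,∞) → ℝ` be four times continuously differentiable
(encoded by successive derivatives `φ', φ'', φ''', φ''''` on `[0,∞)`, the last one continuous)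
with `φ'(0) = 0`, `φ''(0) = 1`, `φ''(r) > 0` for all `r ≥ 0`; let `Δ3 = φ'''(0)` and `Δ4 > 0`
with `|φ''''(r)| ≤ Δ4` for all `r ≥ 0`. Set `r₀ = (Δ3 + √(Δ3² + 2Δ4))/Δ4` and
`ψ(z) = −(2d−1)·log z + φ(z²)` for `z > 0`, with derivatives `ψ', ψ''` on `(0,∞)`. Then:
(i) for all `z > 0` with `z² ≤ r₀`,
    `ψ''(z) ≥ (2d−1)/z² + 6z² + 5Δ3·z⁴ − (7/3)Δ4·z⁶`;
(ii) for all `z > 0` with `z² ≥ r₀`,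
    `ψ''(z) ≥ 2·(r₀ + Δ3·r₀²/2 − Δ4·r₀³/6)`. -/
theorem stmt_9 (d : ℕ) (hd : 1 ≤ d) (φ φ' φ'' φ''' φ'''' : ℝ → ℝ)
    (hD1 : ∀ r ∈ Set.Ici (0:ℝ), HasDerivWithinAt φ (φ' r) (Set.Ici 0) r)
    (hD2 : ∀ r ∈ Set.Ici (0:ℝ), HasDerivWithinAt φ' (φ'' r) (Set.Ici 0) r)
    (hD3 : ∀ r ∈ Set.Ici (0:ℝ), HasDerivWithinAt φ'' (φ''' r) (Set.Ici 0) r)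
    (hD4 : ∀ r ∈ Set.Ici (0:ℝ), HasDerivWithinAt φ''' (φ'''' r) (Set.Ici 0) r)
    (hcont : ContinuousOn φ'''' (Set.Ici 0))
    (h1 : φ' 0 = 0) (h2 : φ'' 0 = 1) (hpos : ∀ r ∈ Set.Ici (0:ℝ), 0 < φ'' r)
    (Δ3 : ℝ) (hΔ3 : Δ3 = φ''' 0)
    (Δ4 : ℝ) (hΔ4 : 0 < Δ4) (hbound : ∀ r ∈ Set.Ici (0:ℝ), |φ'''' r| ≤ Δ4)
    (r₀ : ℝ) (hr₀ : r₀ = (Δ3 + Real.sqrt (Δ3^2 + 2*Δ4))/Δ4)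
    (ψ ψ' ψ'' : ℝ → ℝ)
    (hψ : ∀ z > (0:ℝ), ψ z = -(2*(d:ℝ)-1) * Real.log z + φ (z^2))
    (hψ1 : ∀ z > (0:ℝ), HasDerivAt ψ (ψ' z) z)
    (hψ2 : ∀ z > (0:ℝ), HasDerivAt ψ' (ψ'' z) z) :
    (∀ z > (0:ℝ), z^2 ≤ r₀ →
        (2*(d:ℝ)-1)/z^2 + 6*z^2 + 5*Δ3*z^4 - (7/3)*Δ4*z^6 ≤ ψ'' z) ∧
    (∀ z > (0:ℝ), r₀ ≤ z^2 →
        2*(r₀ + Δ3*r₀^2/2 - Δ4*r₀^3/6) ≤ ψ'' z) := by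
  have hthird : ∀ r ∈ Set.Ici (0:ℝ), Δ3 - Δ4 * r ≤ φ''' r := by
    refine le_of_hasDerivWithinAt_le_Ici (g' := fun _ => -Δ4) hD4 (fun r => ?_) (by simp [hΔ3])
      (fun r hr => (abs_le.1 (hbound r hr)).1)
    simpa using ((hasDerivAt_id r).const_mul Δ4).const_sub Δ3
  have hsecond : ∀ r ∈ Set.Ici (0:ℝ), 1 + Δ3 * r - Δ4 * r^2 / 2 ≤ φ'' r := by
    refine le_of_hasDerivWithinAt_le_Ici hD3 (fun r => ?_) (by simp [h2]) hthird
    refine ((((hasDerivAt_id r).const_mul Δ3).const_add 1).sub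
      (((hasDerivAt_pow 2 r).const_mul Δ4).div_const 2)).congr_deriv ?_
    norm_num
    ring
  have hfirst : ∀ r ∈ Set.Ici (0:ℝ), r + Δ3 * r^2 / 2 - Δ4 * r^3 / 6 ≤ φ' r := by
    refine le_of_hasDerivWithinAt_le_Ici hD2 (fun r => ?_) (by simp [h1]) hsecond
    refine (((hasDerivAt_id r).add (((hasDerivAt_pow 2 r).const_mul Δ3).div_const 2)).sub
      (((hasDerivAt_pow 3 r).const_mul Δ4).div_const 6)).congr_deriv ?_
    norm_num
    ring
  have hmono : MonotoneOn φ' (Set.Ici 0) :=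
    monotoneOn_Ici_of_hasDerivWithinAt_nonneg hD2 fun r hr => (hpos r hr).le
  have hr₀_nonneg : 0 ≤ r₀ := by
    have h : |Δ3| ≤ √(Δ3^2 + 2 * Δ4) := Real.abs_le_sqrt (by linarith)
    rw [hr₀]
    exact div_nonneg (by linarith [neg_abs_le Δ3]) hΔ4.le
  refine ⟨fun z hz _ => ?_, fun z hz hle => ?_⟩ <;>
    rw [second_deriv_neg_log_add_comp_sq hD1 hD2 hψ hψ1 hψ2 hz]
  · have hφ' := hfirst (z^2) (sq_nonneg z)
    have hφ'' := mul_le_mul_of_nonneg_left (hsecond (z^2) (sq_nonneg z))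
      (by positivity : 0 ≤ 4 * z^2)
    linear_combination 2 * hφ' + hφ''
  · have hφ' := (hfirst r₀ hr₀_nonneg).trans (hmono hr₀_nonneg (sq_nonneg z) hle)
    have hφ'' : 0 ≤ 4 * z^2 * φ'' (z^2) :=
      mul_nonneg (by positivity) (hpos _ (sq_nonneg z)).le
    have hd' : (1:ℝ) ≤ d := by exact_mod_cast hd
    have hlog : 0 ≤ (2 * (d:ℝ) - 1) / z^2 := div_nonneg (by linarith) (sq_nonneg z)
    linarith
end

section
/- Let P be a probability measure on a measurable space Ω and let ξ : Ω → ℝ be measurable, integrable and square-integrable with respect to P, and bounded above by M ∈ ℝ. Let Q be the probability measure with density dQ/dP = exp(ξ)/∫exp(ξ)dP with respect to P. Then KL(P, Q) ≤ log[1 + (1/2)·exp(M − ∫ξ dP)·Var_P(ξ)], where Var_P(ξ) = ∫(ξ − ∫ξ dP)² dP. -/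
open MeasureTheory Real

/-- The Kullback–Leibler divergence `KL(P, Q) = ∫ log (dP/dQ) dP`, expressed via the
Radon–Nikodym derivative (`P` is assumed absolutely continuous w.r.t. `Q` when used). -/
noncomputable def klDiv {Ω : Type*} [MeasurableSpace Ω] (P Q : Measure Ω) : ℝ :=
  ∫ x, Real.log ((P.rnDeriv Q x).toReal) ∂P

/-- Second-order Taylor bound for the exponential, on the positive half-line. -/
lemma Real.exp_le_one_add_add_sq_mul_exp {t : ℝ} (ht : 0 ≤ t) :
    Real.exp t ≤ 1 + t + t ^ 2 / 2 * Real.exp t := by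
  have hderiv (x : ℝ) : HasDerivAt (fun y : ℝ => (1 + y) * Real.exp (-y) + y ^ 2 / 2)
      (x * (1 - Real.exp (-x))) x := by
    refine ((((hasDerivAt_id' x).const_add 1).mul (hasDerivAt_neg x).exp).add
      (((hasDerivAt_id' x).pow 2).div_const 2)).congr_deriv ?_
    norm_num
    ring
  have hmono : MonotoneOn (fun y : ℝ => (1 + y) * Real.exp (-y) + y ^ 2 / 2) (Set.Ici 0) := by
    refine monotoneOn_of_deriv_nonneg (convex_Ici 0)
      (fun x _ => (hderiv x).continuousAt.continuousWithinAt)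
      (fun x _ => (hderiv x).differentiableAt.differentiableWithinAt) fun x hx => ?_
    rw [interior_Ici, Set.mem_Ioi] at hx
    rw [(hderiv x).deriv]
    exact mul_nonneg hx.le (sub_nonneg.2 (Real.exp_le_one_iff.2 (by linarith)))
  have h := hmono Set.self_mem_Ici ht ht
  norm_num at h
  calc Real.exp t ≤ ((1 + t) * Real.exp (-t) + t ^ 2 / 2) * Real.exp t :=
        le_mul_of_one_le_left (Real.exp_pos t).le h
    _ = 1 + t + t ^ 2 / 2 * Real.exp t := by
        rw [add_mul, mul_assoc, ← Real.exp_add]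
        simp

/-- Second-order Taylor bound for the exponential, on the negative half-line. -/
lemma Real.exp_le_one_add_add_sq_of_nonpos {t : ℝ} (ht : t ≤ 0) :
    Real.exp t ≤ 1 + t + t ^ 2 / 2 := by
  have h := Real.quadratic_le_exp_of_nonneg (neg_nonneg.2 ht)
  have hpos : 0 ≤ 1 + t + t ^ 2 / 2 := by nlinarith [sq_nonneg (t + 1)]
  calc Real.exp t ≤ Real.exp t * ((1 + -t + (-t) ^ 2 / 2) * (1 + t + t ^ 2 / 2)) := by
        refine le_mul_of_one_le_right (Real.exp_pos t).le ?_
        nlinarith [sq_nonneg (t ^ 2)]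
    _ ≤ Real.exp t * (Real.exp (-t) * (1 + t + t ^ 2 / 2)) := by gcongr
    _ = 1 + t + t ^ 2 / 2 := by rw [← mul_assoc, ← Real.exp_add]; simp

lemma Real.exp_le_one_add_add_exp_mul_sq {t c : ℝ} (hc : 0 ≤ c) (htc : t ≤ c) :
    Real.exp t ≤ 1 + t + 1 / 2 * Real.exp c * t ^ 2 := by
  rcases le_total 0 t with ht | ht
  · have h := Real.exp_le_one_add_add_sq_mul_exp ht
    have := mul_le_mul_of_nonneg_left (Real.exp_le_exp.2 htc) (by positivity : 0 ≤ t ^ 2 / 2)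
    linarith
  · have h := Real.exp_le_one_add_add_sq_of_nonpos ht
    have := mul_le_mul_of_nonneg_left (Real.one_le_exp hc) (by positivity : 0 ≤ t ^ 2 / 2)
    linarith

/-- Let `P` be a probability measure, `ξ` measurable, integrable and
square-integrable w.r.t. `P`, bounded above by `M`. Let `Q` be the probability measure with
density `exp ξ / ∫ exp ξ dP` w.r.t. `P`. Then
`KL(P, Q) ≤ log [1 + (1/2)·exp(M − ∫ ξ dP)·Var_P(ξ)]`, where
`Var_P(ξ) = ∫ (ξ − ∫ ξ dP)² dP`. -/
theorem stmt_11 {Ω : Type*} [MeasurableSpace Ω] (P : Measure Ω) [IsProbabilityMeasure P]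
    (ξ : Ω → ℝ) (hmeas : Measurable ξ) (hint : Integrable ξ P)
    (hsq : Integrable (fun x => (ξ x)^2) P)
    (M : ℝ) (hM : ∀ x, ξ x ≤ M)
    (Q : Measure Ω)
    (hQ : Q = P.withDensity fun x =>
      ENNReal.ofReal (Real.exp (ξ x) / ∫ y, Real.exp (ξ y) ∂P)) :
    klDiv P Q ≤ Real.log (1 + (1/2) * Real.exp (M - ∫ y, ξ y ∂P)
      * ∫ x, (ξ x - ∫ y, ξ y ∂P)^2 ∂P) := by
  have hexp : Integrable (fun x => Real.exp (ξ x)) P :=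
    (integrable_const (Real.exp M)).mono' hmeas.exp.aestronglyMeasurable
      (.of_forall fun x => by simpa using hM x)
  have hkl : klDiv P Q = Real.log (∫ x, Real.exp (ξ x) ∂P) - ∫ x, ξ x ∂P := by
    have hself : llr P P =ᵐ[P] 0 := llr_self P
    have h := integral_llr_tilted_right (Measure.AbsolutelyContinuous.refl P) hint hexp
      ((integrable_zero Ω ℝ P).congr hself.symm)
    rw [integral_congr_ae hself] at h
    subst hQ
    simp only [Pi.zero_apply, integral_zero] at h
    change ∫ x, llr P (P.tilted ξ) x ∂P = _
    linarith
  set m := ∫ y, ξ y ∂P with hm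
  have hmM : m ≤ M := by
    simpa using integral_mono hint (integrable_const M) hM
  have hcent : Integrable (fun x => ξ x - m) P := hint.sub (integrable_const m)
  have hcent_sq : Integrable (fun x => (ξ x - m) ^ 2) P := by
    refine ((hsq.sub (hint.const_mul (2 * m))).add (integrable_const (m ^ 2))).congr
      (.of_forall fun x => ?_)
    simp only [Pi.add_apply, Pi.sub_apply]
    ring
  have hlin : Integrable (fun x => 1 + (ξ x - m)) P := (integrable_const 1).add hcent
  have hquad := hcent_sq.const_mul (1 / 2 * Real.exp (M - m))
  have hbound : (∫ x, Real.exp (ξ x) ∂P) * Real.exp (-m) ≤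
      1 + 1 / 2 * Real.exp (M - m) * ∫ x, (ξ x - m) ^ 2 ∂P := by
    calc (∫ x, Real.exp (ξ x) ∂P) * Real.exp (-m)
        = ∫ x, Real.exp (ξ x) * Real.exp (-m) ∂P := (integral_mul_const _ _).symm
      _ ≤ ∫ x, (1 + (ξ x - m) + 1 / 2 * Real.exp (M - m) * (ξ x - m) ^ 2) ∂P := by
          refine integral_mono (hexp.mul_const _) (hlin.add hquad) fun x => ?_
          dsimp only
          rw [← Real.exp_add, ← sub_eq_add_neg]
          exact Real.exp_le_one_add_add_exp_mul_sq (sub_nonneg.2 hmM)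
            (sub_le_sub_right (hM x) m)
      _ = 1 + 1 / 2 * Real.exp (M - m) * ∫ x, (ξ x - m) ^ 2 ∂P := by
          rw [integral_add hlin hquad, integral_add (integrable_const 1) hcent,
            integral_sub hint (integrable_const m), integral_const_mul]
          simp [← hm]
  have hZ : 0 < ∫ x, Real.exp (ξ x) ∂P := integral_exp_pos hexp
  calc klDiv P Q = Real.log ((∫ x, Real.exp (ξ x) ∂P) * Real.exp (-m)) := by
        rw [hkl, Real.log_mul hZ.ne' (Real.exp_pos _).ne', Real.log_exp, sub_eq_add_neg]
    _ ≤ _ := Real.log_le_log (mul_pos hZ (Real.exp_pos _)) hbound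
end
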